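/- Assume the COLD setup for some k ≥ 1, fix subsets S, S̄ ⊆ {1,…,k}, and let E split X into sets of size 2. Then there exists a random variable U, adjoinable to all the given variables, that is uniform over a 2-element set and satisfies I(U; (E, V_S, V̄_S̄)) = 0 and H(F | V_S, V̄_S̄, E, U) = 0, if and only if a_e ≠ 1 for every e with P(E=e) > 0. -/

import Mathlib

namespace CIPaper

/-- A bundled probability space. -/
structure ProbSpace where
  carrier : Type
  [inst : MeasurableSpace carrier]
  μ : MeasureTheory.Measure carrier
  [isProb : MeasureTheory.IsProbabilityMeasure μ]

attribute [instance] ProbSpace.inst ProbSpace.isProb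

/-- A bundled finite measurable alphabet, used as value space of auxiliary random variables. -/
structure FinAlphabet where
  carrier : Type
  [fin : Fintype carrier]
  [ms : MeasurableSpace carrier]
  [msc : MeasurableSingletonClass carrier]

attribute [instance] FinAlphabet.fin FinAlphabet.ms FinAlphabet.msc

open MeasureTheory ProbabilityTheory Real

variable {Ω : Type*} [MeasurableSpace Ω] {S T U : Type*}

/-- P(X = x). -/
noncomputable def pr (μ : Measure Ω) (X : Ω → S) (x : S) : ℝ :=
  (μ (X ⁻¹' {x})).toReal

/-- Shannon entropy (base 2) of a finite-valued random variable. -/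
noncomputable def ent (μ : Measure Ω) [Fintype S] (X : Ω → S) : ℝ :=
  (∑ x, Real.negMulLog (pr μ X x)) / Real.log 2

/-- Conditional entropy H(X|Y). -/
noncomputable def condEnt (μ : Measure Ω) [Fintype S] [Fintype T]
    (X : Ω → S) (Y : Ω → T) : ℝ :=
  ent μ (fun ω => (X ω, Y ω)) - ent μ Y

/-- Mutual information I(X;Y). -/
noncomputable def mi (μ : Measure Ω) [Fintype S] [Fintype T]
    (X : Ω → S) (Y : Ω → T) : ℝ :=
  ent μ X + ent μ Y - ent μ (fun ω => (X ω, Y ω))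

/-- Conditional mutual information I(X;Y|Z). -/
noncomputable def cmi (μ : Measure Ω) [Fintype S] [Fintype T] [Fintype U]
    (X : Ω → S) (Y : Ω → T) (Z : Ω → U) : ℝ :=
  ent μ (fun ω => (X ω, Z ω)) + ent μ (fun ω => (Y ω, Z ω))
    - ent μ (fun ω => (X ω, (Y ω, Z ω))) - ent μ Z

/-- The support of a random variable: values of positive probability. -/
def support (μ : Measure Ω) (X : Ω → S) : Set S := {x | 0 < pr μ X x}

/-- X is uniformly distributed over its support. -/
def IsUniform (μ : Measure Ω) (X : Ω → S) : Prop :=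
  ∀ x ∈ support μ X, ∀ y ∈ support μ X, pr μ X x = pr μ X y

/-- X is uniformly distributed over a support of size n. -/
def UniformOn (μ : Measure Ω) (X : Ω → S) (n : ℕ) : Prop :=
  IsUniform μ X ∧ (support μ X).ncard = n

/-- The TRIPLE predicate: pairwise independence plus each variable a function of the
other two. -/
def TRIPLE (μ : Measure Ω) [Fintype S] [Fintype T] [Fintype U]
    (X : Ω → S) (Y : Ω → T) (Z : Ω → U) : Prop :=
  condEnt μ X (fun ω => (Y ω, Z ω)) = 0 ∧ condEnt μ Y (fun ω => (X ω, Z ω)) = 0 ∧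
    condEnt μ Z (fun ω => (X ω, Y ω)) = 0 ∧
    mi μ X Y = 0 ∧ mi μ X Z = 0 ∧ mi μ Y Z = 0

end CIPaper

namespace CIPaper

open MeasureTheory ProbabilityTheory Real

/-- E splits X into sets of size l: E is a function of X and, conditioned on any value e
of positive probability, X is uniform over exactly l values. -/
def Splits {Ω : Type*} [MeasurableSpace Ω] (μ : Measure Ω) {SX SE : Type*}
    [Fintype SX] [Fintype SE] (X : Ω → SX) (E : Ω → SE) (l : ℕ) : Prop :=
  condEnt μ E X = 0 ∧
  ∀ e : SE, 0 < pr μ E e →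
    (∀ x : SX, pr μ (fun ω => (X ω, E ω)) (x, e) = 0 ∨
        pr μ (fun ω => (X ω, E ω)) (x, e) = pr μ E e / l) ∧
    Set.ncard {x : SX | 0 < pr μ (fun ω => (X ω, E ω)) (x, e)} = l

/-- a_e: the number of values x of X compatible with E = e whose label w(x) satisfies
sat(w(x), S, S̄) = 1. -/
noncomputable def aCount {Ω : Type*} [MeasurableSpace Ω] (μ : Measure Ω) {SX SE : Type*}
    (k : ℕ) (X : Ω → SX) (E : Ω → SE) (wfun : SX → (Fin k → Fin 2))
    (S Sb : Finset (Fin k)) (e : SE) : ℕ :=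
  Set.ncard {x : SX | 0 < pr μ (fun ω => (X ω, E ω)) (x, e) ∧
    (∀ i ∈ S, wfun x i = 1) ∧ ∀ i ∈ Sb, wfun x i = 0}

section Entropy

variable {Ω S T R : Type*} [MeasurableSpace Ω]

theorem pr_nonneg (μ : Measure Ω) (X : Ω → S) (x : S) : 0 ≤ pr μ X x :=
  ENNReal.toReal_nonneg

theorem sum_pr_pair [Fintype S] [MeasurableSpace S] [MeasurableSingletonClass S]
    (μ : Measure Ω) [IsFiniteMeasure μ] {X : Ω → S} (hX : Measurable X) (Y : Ω → T) (y : T) :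
    ∑ x, pr μ (fun ω => (X ω, Y ω)) (x, y) = pr μ Y y := by
  have h := sum_measure_preimage_singleton (μ := μ.restrict (Y ⁻¹' {y})) (f := X) Finset.univ
    (fun x _ => hX (measurableSet_singleton x))
  have h' : ∀ x, (μ.restrict (Y ⁻¹' {y})) (X ⁻¹' {x})
      = μ ((fun ω => (X ω, Y ω)) ⁻¹' {(x, y)}) := by
    intro x
    rw [Measure.restrict_apply (hX (measurableSet_singleton x))]
    congr 1
    ext ω
    simp
  simp only [h', Finset.coe_univ, Set.preimage_univ, Measure.restrict_apply_univ] at h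
  simp only [pr, ← h]
  exact (ENNReal.toReal_sum fun x _ => measure_ne_top _ _).symm

theorem sum_pr [Fintype S] [MeasurableSpace S] [MeasurableSingletonClass S]
    (μ : Measure Ω) [IsProbabilityMeasure μ] {X : Ω → S} (hX : Measurable X) :
    ∑ x, pr μ X x = 1 := by
  have h := sum_measure_preimage_singleton (μ := μ) (f := X) Finset.univ
    (fun x _ => hX (measurableSet_singleton x))
  simp only [pr]
  rw [← ENNReal.toReal_sum fun x _ => measure_ne_top _ _, h]
  simp

theorem pr_swap (μ : Measure Ω) (X : Ω → S) (Y : Ω → T) (x : S) (y : T) :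
    pr μ (fun ω => (X ω, Y ω)) (x, y) = pr μ (fun ω => (Y ω, X ω)) (y, x) := by
  simp only [pr]
  congr 2
  ext ω
  simp [and_comm]

theorem sum_pr_pair_right [Fintype T] [MeasurableSpace T] [MeasurableSingletonClass T]
    (μ : Measure Ω) [IsFiniteMeasure μ] (X : Ω → S) {Y : Ω → T} (hY : Measurable Y) (x : S) :
    ∑ y, pr μ (fun ω => (X ω, Y ω)) (x, y) = pr μ X x := by
  simp only [pr_swap μ X Y, sum_pr_pair μ hY X x]

theorem pr_pair_le_right (μ : Measure Ω) [IsFiniteMeasure μ] (X : Ω → S) (Y : Ω → T)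
    (x : S) (y : T) : pr μ (fun ω => (X ω, Y ω)) (x, y) ≤ pr μ Y y :=
  ENNReal.toReal_mono (measure_ne_top _ _) (measure_mono fun ω hω => by simp_all)

theorem pr_pair_le_left (μ : Measure Ω) [IsFiniteMeasure μ] (X : Ω → S) (Y : Ω → T)
    (x : S) (y : T) : pr μ (fun ω => (X ω, Y ω)) (x, y) ≤ pr μ X x :=
  ENNReal.toReal_mono (measure_ne_top _ _) (measure_mono fun ω hω => by simp_all)

theorem condEnt_eq_zero_iff [Fintype S] [Fintype T] [MeasurableSpace S]
    [MeasurableSingletonClass S] (μ : Measure Ω) [IsFiniteMeasure μ] {X : Ω → S}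
    (hX : Measurable X) (Y : Ω → T) :
    condEnt μ X Y = 0 ↔ ∀ x y, pr μ (fun ω => (X ω, Y ω)) (x, y) = 0 ∨
      pr μ (fun ω => (X ω, Y ω)) (x, y) = pr μ Y y := by
  set p : S × T → ℝ := pr μ (fun ω => (X ω, Y ω)) with hp
  have h0 : ∀ z, 0 ≤ p z := pr_nonneg _ _
  have hle : ∀ x y, p (x, y) ≤ pr μ Y y := pr_pair_le_right μ X Y
  have hexp : condEnt μ X Y
      = (∑ z : S × T, p z * (Real.log (pr μ Y z.2) - Real.log (p z))) / Real.log 2 := by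
    simp only [condEnt, ent, ← hp, ← sub_div]
    congr 1
    have : ∑ y, negMulLog (pr μ Y y) = ∑ z : S × T, -(p z * Real.log (pr μ Y z.2)) := by
      rw [Fintype.sum_prod_type_right]
      refine Finset.sum_congr rfl fun y _ => ?_
      simp only [Finset.sum_neg_distrib]
      rw [← Finset.sum_mul, hp, sum_pr_pair μ hX Y y, negMulLog, neg_mul]
    rw [this, ← Finset.sum_sub_distrib]
    refine Finset.sum_congr rfl fun z _ => ?_
    rw [negMulLog]
    ring
  have hterm : ∀ z ∈ (Finset.univ : Finset (S × T)),
      0 ≤ p z * (Real.log (pr μ Y z.2) - Real.log (p z)) := by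
    rintro ⟨x, y⟩ -
    rcases (h0 (x, y)).eq_or_lt with h | h
    · simp [← h]
    · exact mul_nonneg h.le (sub_nonneg.2 (Real.log_le_log h (hle x y)))
  have hlog : Real.log 2 ≠ 0 := (Real.log_pos one_lt_two).ne'
  rw [hexp, div_eq_zero_iff, or_iff_left hlog, Finset.sum_eq_zero_iff_of_nonneg hterm]
  constructor
  · intro h x y
    rcases (h0 (x, y)).eq_or_lt with h1 | h1
    · exact Or.inl h1.symm
    · right
      have h2 := (mul_eq_zero.1 (h (x, y) (Finset.mem_univ _))).resolve_left h1.ne'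
      exact (Real.log_injOn_pos (h1.trans_le (hle x y)) h1 (sub_eq_zero.1 h2)).symm
  · rintro h ⟨x, y⟩ -
    rcases h x y with h | h <;> simp [h]

/-- Equality case of Gibbs' inequality for finite nonnegative families of equal mass. -/
theorem eq_of_sum_mul_log_eq_zero {ι : Type*} [Fintype ι] {a b : ι → ℝ} (ha : ∀ i, 0 ≤ a i)
    (hb : ∀ i, 0 ≤ b i) (hab : ∀ i, b i = 0 → a i = 0) (hsum : ∑ i, a i = ∑ i, b i)
    (h : ∑ i, a i * (Real.log (a i) - Real.log (b i)) = 0) (i : ι) : a i = b i := by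
  have key : ∀ i, 0 ≤ a i * (Real.log (a i) - Real.log (b i)) - a i + b i ∧
      (a i * (Real.log (a i) - Real.log (b i)) - a i + b i = 0 → a i = b i) := by
    intro i
    rcases (ha i).eq_or_lt with h0 | h0
    · rw [← h0]
      simpa [eq_comm] using hb i
    have hbi : 0 < b i := (hb i).lt_of_ne fun h1 => h0.ne' (hab i h1.symm)
    have hr : 0 < b i / a i := div_pos hbi h0
    have hl : Real.log (a i) - Real.log (b i) = -Real.log (b i / a i) := by
      rw [Real.log_div hbi.ne' h0.ne']
      ring
    have hm : a i * (b i / a i - 1) = b i - a i := by field_simp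
    rw [hl]
    constructor
    · nlinarith [mul_le_mul_of_nonneg_left (Real.log_le_sub_one_of_pos hr) h0.le]
    · intro h1
      by_contra hne
      have : b i / a i ≠ 1 := fun h2 => hne ((div_eq_one_iff_eq h0.ne').1 h2).symm
      nlinarith [mul_lt_mul_of_pos_left (Real.log_lt_sub_one_of_pos hr this) h0]
  have hs : ∑ i, (a i * (Real.log (a i) - Real.log (b i)) - a i + b i) = 0 := by
    rw [Finset.sum_add_distrib, Finset.sum_sub_distrib, h, hsum]
    ring
  exact (key i).2 ((Finset.sum_eq_zero_iff_of_nonneg fun i _ => (key i).1).1 hs i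
    (Finset.mem_univ i))

theorem mi_eq_zero_iff [Fintype S] [Fintype T] [MeasurableSpace S]
    [MeasurableSingletonClass S] [MeasurableSpace T] [MeasurableSingletonClass T]
    (μ : Measure Ω) [IsProbabilityMeasure μ] {X : Ω → S} {Y : Ω → T}
    (hX : Measurable X) (hY : Measurable Y) :
    mi μ X Y = 0 ↔ ∀ x y, pr μ (fun ω => (X ω, Y ω)) (x, y) = pr μ X x * pr μ Y y := by
  set p : S × T → ℝ := pr μ (fun ω => (X ω, Y ω)) with hp
  have hpX : ∀ x, ∑ y, p (x, y) = pr μ X x := sum_pr_pair_right μ X hY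
  have hpY : ∀ y, ∑ x, p (x, y) = pr μ Y y := sum_pr_pair μ hX Y
  have hab : ∀ z : S × T, pr μ X z.1 * pr μ Y z.2 = 0 → p z = 0 := by
    rintro ⟨x, y⟩ h
    refine le_antisymm ?_ (pr_nonneg _ _ _)
    rcases mul_eq_zero.1 h with h | h
    · exact h ▸ pr_pair_le_left μ X Y x y
    · exact h ▸ pr_pair_le_right μ X Y x y
  have hexp : mi μ X Y = (∑ z : S × T,
      p z * (Real.log (p z) - Real.log (pr μ X z.1 * pr μ Y z.2))) / Real.log 2 := by
    have h1 : ∑ x, negMulLog (pr μ X x) = ∑ z : S × T, -(p z * Real.log (pr μ X z.1)) := by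
      rw [Fintype.sum_prod_type]
      refine Finset.sum_congr rfl fun x _ => ?_
      simp only [Finset.sum_neg_distrib]
      rw [← Finset.sum_mul, hpX, negMulLog, neg_mul]
    have h2 : ∑ y, negMulLog (pr μ Y y) = ∑ z : S × T, -(p z * Real.log (pr μ Y z.2)) := by
      rw [Fintype.sum_prod_type_right]
      refine Finset.sum_congr rfl fun y _ => ?_
      simp only [Finset.sum_neg_distrib]
      rw [← Finset.sum_mul, hpY, negMulLog, neg_mul]
    simp only [mi, ent, ← hp, ← sub_div, ← add_div]
    rw [h1, h2, ← Finset.sum_add_distrib, ← Finset.sum_sub_distrib]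
    congr 1
    refine Finset.sum_congr rfl fun z _ => ?_
    by_cases hz : p z = 0
    · simp [hz]
    have hne : pr μ X z.1 * pr μ Y z.2 ≠ 0 := fun h => hz (hab z h)
    rw [negMulLog, Real.log_mul (left_ne_zero_of_mul hne) (right_ne_zero_of_mul hne)]
    ring
  have hlog : Real.log 2 ≠ 0 := (Real.log_pos one_lt_two).ne'
  rw [hexp, div_eq_zero_iff, or_iff_left hlog]
  constructor
  · intro h x y
    have hsum : ∑ z, p z = ∑ z : S × T, pr μ X z.1 * pr μ Y z.2 := by
      simp only [Fintype.sum_prod_type, hpX, ← Finset.mul_sum, sum_pr μ hY, mul_one]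
    exact eq_of_sum_mul_log_eq_zero (pr_nonneg _ _)
      (fun z : S × T => mul_nonneg (pr_nonneg μ X z.1) (pr_nonneg μ Y z.2)) hab hsum h (x, y)
  · intro h
    refine Finset.sum_eq_zero fun z _ => ?_
    rw [h z.1 z.2, sub_self, mul_zero]

theorem mul_eq_mul_of_cmi_eq_zero [Fintype S] [Fintype T] [Fintype R] [MeasurableSpace S]
    [MeasurableSingletonClass S] [MeasurableSpace T] [MeasurableSingletonClass T]
    (μ : Measure Ω) [IsFiniteMeasure μ] {X : Ω → S} {Y : Ω → T}
    {Z : Ω → R} (hX : Measurable X) (hY : Measurable Y)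
    (h : cmi μ X Y Z = 0) (x : S) (y : T) (z : R) :
    pr μ (fun ω => (X ω, (Y ω, Z ω))) (x, (y, z)) * pr μ Z z
      = pr μ (fun ω => (X ω, Z ω)) (x, z) * pr μ (fun ω => (Y ω, Z ω)) (y, z) := by
  set p : S × T × R → ℝ := pr μ (fun ω => (X ω, (Y ω, Z ω))) with hp
  set pX : S × R → ℝ := pr μ (fun ω => (X ω, Z ω)) with hpX
  set pY : T × R → ℝ := pr μ (fun ω => (Y ω, Z ω)) with hpY
  have h0 : ∀ t, 0 ≤ p t := pr_nonneg _ _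
  have hsX : ∀ y z, ∑ x, p (x, (y, z)) = pY (y, z) := fun y z => sum_pr_pair μ hX _ _
  have hrot : ∀ x y z, p (x, (y, z)) = pr μ (fun ω => (Y ω, (X ω, Z ω))) (y, (x, z)) := by
    intro x y z
    simp only [hp, pr]
    congr 2
    ext ω
    simp only [Set.mem_preimage, Set.mem_singleton_iff, Prod.mk.injEq]
    tauto
  have hsY : ∀ x z, ∑ y, p (x, (y, z)) = pX (x, z) := by
    intro x z
    simp only [hrot]
    exact sum_pr_pair μ hY _ _
  have hsXZ : ∀ z, ∑ x, pX (x, z) = pr μ Z z := fun z => sum_pr_pair μ hX _ _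
  have hsYZ : ∀ z, ∑ y, pY (y, z) = pr μ Z z := fun z => sum_pr_pair μ hY _ _
  have hleY : ∀ x y z, p (x, (y, z)) ≤ pY (y, z) := fun x y z => pr_pair_le_right μ X _ x (y, z)
  have hleX : ∀ x y z, p (x, (y, z)) ≤ pX (x, z) := fun x y z => by
    rw [hrot]
    exact pr_pair_le_right μ Y _ y (x, z)
  have hleZ : ∀ x z, pX (x, z) ≤ pr μ Z z := pr_pair_le_right μ X Z
  set b : S × T × R → ℝ := fun t => pX (t.1, t.2.2) * pY (t.2.1, t.2.2) / pr μ Z t.2.2 with hb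
  have hb0 : ∀ t, 0 ≤ b t := fun t =>
    div_nonneg (mul_nonneg (pr_nonneg _ _ _) (pr_nonneg _ _ _)) (pr_nonneg _ _ _)
  have hpos : ∀ x y z, p (x, (y, z)) ≠ 0 →
      0 < pX (x, z) ∧ 0 < pY (y, z) ∧ 0 < pr μ Z z := by
    intro x y z ht
    have hlt := (h0 (x, (y, z))).lt_of_ne' ht
    exact ⟨hlt.trans_le (hleX x y z), hlt.trans_le (hleY x y z),
      hlt.trans_le ((hleX x y z).trans (hleZ x z))⟩
  have hab : ∀ t, b t = 0 → p t = 0 := by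
    rintro ⟨x, y, z⟩ ht
    by_contra hne
    obtain ⟨h1, h2, h3⟩ := hpos x y z hne
    exact (div_pos (mul_pos h1 h2) h3).ne' ht
  have hsum : ∑ t, p t = ∑ t, b t := by
    simp only [Fintype.sum_prod_type_right, hb, hsX, hsYZ, ← Finset.sum_div, ← Finset.sum_mul,
      hsXZ]
    refine Finset.sum_congr rfl fun z _ => ?_
    rw [← Finset.mul_sum, hsYZ]
    by_cases hz : pr μ Z z = 0
    · simp [hz]
    · field_simp
  have hexp : cmi μ X Y Z
      = (∑ t, p t * (Real.log (p t) - Real.log (b t))) / Real.log 2 := by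
    have e1 : ∑ s, negMulLog (pX s)
        = ∑ t : S × T × R, -(p t * Real.log (pX (t.1, t.2.2))) := by
      simp only [Fintype.sum_prod_type, Finset.sum_neg_distrib]
      rw [← Finset.sum_neg_distrib]
      refine Finset.sum_congr rfl fun x _ => ?_
      rw [Finset.sum_comm, ← Finset.sum_neg_distrib]
      refine Finset.sum_congr rfl fun z _ => ?_
      rw [← Finset.sum_mul, hsY, negMulLog, neg_mul]
    have e2 : ∑ s, negMulLog (pY s) = ∑ t : S × T × R, -(p t * Real.log (pY t.2)) := by
      symm
      rw [Fintype.sum_prod_type_right]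
      refine Finset.sum_congr rfl fun y _ => ?_
      rw [Finset.sum_neg_distrib]
      dsimp only
      rw [← Finset.sum_mul, hsX y.1 y.2, negMulLog, neg_mul]
    have e3 : ∑ z, negMulLog (pr μ Z z)
        = ∑ t : S × T × R, -(p t * Real.log (pr μ Z t.2.2)) := by
      rw [Fintype.sum_prod_type_right, Fintype.sum_prod_type_right]
      refine Finset.sum_congr rfl fun z _ => ?_
      simp only [Finset.sum_neg_distrib, ← Finset.sum_mul, hsX, hsYZ]
      rw [negMulLog, neg_mul]
    simp only [cmi, ent, ← hp, ← hpX, ← hpY, ← sub_div, ← add_div]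
    rw [e1, e2, e3, ← Finset.sum_add_distrib, ← Finset.sum_sub_distrib,
      ← Finset.sum_sub_distrib]
    congr 1
    refine Finset.sum_congr rfl ?_
    rintro ⟨x, y, z⟩ -
    by_cases ht : p (x, (y, z)) = 0
    · simp [ht]
    obtain ⟨h1, h2, h3⟩ := hpos x y z ht
    simp only [hb]
    rw [negMulLog, Real.log_div (mul_pos h1 h2).ne' h3.ne', Real.log_mul h1.ne' h2.ne']
    ring
  have hlog : Real.log 2 ≠ 0 := (Real.log_pos one_lt_two).ne'
  rw [hexp, div_eq_zero_iff, or_iff_left hlog] at h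
  have := eq_of_sum_mul_log_eq_zero h0 hb0 hab hsum h (x, (y, z))
  rw [this]
  by_cases hz : pr μ Z z = 0
  · have hx : pX (x, z) = 0 := le_antisymm (hz ▸ hleZ x z) (pr_nonneg _ _ _)
    rw [hz, hx]
    ring
  · simp only [hb]
    field_simp

end Entropy

section Law

variable {Ω A B S T : Type*} [MeasurableSpace Ω]

theorem pr_congr_ae {μ : Measure Ω} {X : Ω → S} {Y : Ω → T} {x : S} {y : T}
    (h : ∀ᵐ ω ∂μ, X ω = x ↔ Y ω = y) : pr μ X x = pr μ Y y := by
  simp only [pr]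
  rw [measure_congr]
  filter_upwards [h] with ω hω
  exact propext hω

theorem pr_congr {μ : Measure Ω} {X : Ω → S} {Y : Ω → T} {x : S} {y : T}
    (h : ∀ ω, X ω = x ↔ Y ω = y) : pr μ X x = pr μ Y y :=
  pr_congr_ae (ae_of_all _ h)

theorem pr_eq_zero_of_forall_ne {μ : Measure Ω} {X : Ω → S} {x : S} (h : ∀ ω, X ω ≠ x) :
    pr μ X x = 0 := by
  have : X ⁻¹' {x} = ∅ := Set.eq_empty_of_forall_notMem h
  simp [pr, this]

theorem pr_comp_of_injective {g : S → T} (hg : Function.Injective g) (μ : Measure Ω)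
    (X : Ω → S) (x : S) : pr μ (fun ω => g (X ω)) (g x) = pr μ X x :=
  pr_congr fun _ => hg.eq_iff

theorem pr_pair_of_indepFun [MeasurableSpace S] [MeasurableSingletonClass S]
    [MeasurableSpace T] [MeasurableSingletonClass T] {μ : Measure Ω} {X : Ω → S} {Y : Ω → T}
    (h : IndepFun X Y μ) (x : S) (y : T) :
    pr μ (fun ω => (X ω, Y ω)) (x, y) = pr μ X x * pr μ Y y := by
  have := h.measure_inter_preimage_eq_mul {x} {y} (measurableSet_singleton x)
    (measurableSet_singleton y)
  rw [pr, pr, pr, ← ENNReal.toReal_mul, ← this]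
  congr 2
  ext ω
  simp

theorem indepFun_of_pr_pair [Finite S] [Finite T] [MeasurableSpace S]
    [MeasurableSingletonClass S] [MeasurableSpace T] [MeasurableSingletonClass T]
    {μ : Measure Ω} [IsFiniteMeasure μ] {X : Ω → S} {Y : Ω → T} (hX : Measurable X)
    (hY : Measurable Y)
    (h : ∀ x y, pr μ (fun ω => (X ω, Y ω)) (x, y) = pr μ X x * pr μ Y y) :
    IndepFun X Y μ := by
  rw [indepFun_iff_map_prod_eq_prod_map_map hX.aemeasurable hY.aemeasurable]
  refine Measure.ext_of_singleton ?_
  rintro ⟨x, y⟩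
  rw [Measure.map_apply (hX.prodMk hY) (measurableSet_singleton _), ← Set.singleton_prod_singleton,
    Measure.prod_prod, Measure.map_apply hX (measurableSet_singleton _),
    Measure.map_apply hY (measurableSet_singleton _), Set.singleton_prod_singleton]
  have := h x y
  rw [pr, pr, pr, ← ENNReal.toReal_mul] at this
  exact (ENNReal.toReal_eq_toReal_iff' (measure_ne_top _ _)
    (ENNReal.mul_ne_top (measure_ne_top _ _) (measure_ne_top _ _))).1 this

theorem pr_comp_eq_of_identDistrib {Ω' : Type*} [MeasurableSpace Ω'] [MeasurableSpace A]
    [DiscreteMeasurableSpace A] {μ : Measure Ω} {ν : Measure Ω'} {T : Ω → A} {T' : Ω' → A}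
    (h : IdentDistrib T T' μ ν) (g : A → B) (b : B) :
    pr ν (fun ω => g (T' ω)) b = pr μ (fun ω => g (T ω)) b := by
  have := h.measure_mem_eq (s := g ⁻¹' {b}) (MeasurableSet.of_discrete)
  simp only [pr]
  exact congrArg ENNReal.toReal this.symm

theorem exists_ae_eq_comp_of_condEnt_eq_zero [Fintype S] [Fintype T] [MeasurableSpace S]
    [MeasurableSingletonClass S] [MeasurableSpace T] [MeasurableSingletonClass T]
    {μ : Measure Ω} [IsProbabilityMeasure μ] {X : Ω → S} {Y : Ω → T} (hX : Measurable X)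
    (hY : Measurable Y) (h : condEnt μ X Y = 0) : ∃ φ : T → S, ∀ᵐ ω ∂μ, X ω = φ (Y ω) := by
  have hne : Nonempty S := (nonempty_of_isProbabilityMeasure μ).map X
  rw [condEnt_eq_zero_iff μ hX] at h
  have key : ∀ y, ∃ x, ∀ᵐ ω ∂μ, Y ω = y → X ω = x := by
    intro y
    by_cases hy : pr μ Y y = 0
    · obtain ⟨x⟩ := hne
      refine ⟨x, ?_⟩
      have h0 : μ (Y ⁻¹' {y}) = 0 :=
        (ENNReal.toReal_eq_zero_iff _).1 hy |>.resolve_right (measure_ne_top _ _)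
      filter_upwards [measure_eq_zero_iff_ae_notMem.1 h0] with ω hω hω'
      exact absurd hω' hω
    · obtain ⟨x, -, hx⟩ := Finset.exists_ne_zero_of_sum_ne_zero
        ((sum_pr_pair μ hX Y y).trans_ne hy)
      refine ⟨x, ?_⟩
      have heq := (h x y).resolve_left hx
      have hsub : (fun ω => (X ω, Y ω)) ⁻¹' {(x, y)} ⊆ Y ⁻¹' {y} := fun ω hω => by simp_all
      have hae := ae_eq_of_subset_of_measure_ge hsub
        ((ENNReal.toReal_eq_toReal_iff' (measure_ne_top _ _) (measure_ne_top _ _)).1 heq).ge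
        ((hX.prodMk hY) (measurableSet_singleton _)).nullMeasurableSet (measure_ne_top _ _)
      filter_upwards [hae] with ω hω hωy
      have : (fun ω => (X ω, Y ω)) ω = (x, y) := (iff_of_eq hω).2 hωy
      exact congrArg Prod.fst this
  choose φ hφ using key
  refine ⟨φ, ?_⟩
  filter_upwards [ae_all_iff.2 hφ] with ω hω
  exact hω _ rfl

theorem indepFun_of_cmi_eq_zero [Fintype A] [Fintype S] [Fintype T] [MeasurableSpace A]
    [MeasurableSingletonClass A] [MeasurableSpace S] [MeasurableSingletonClass S]
    [MeasurableSpace T] [MeasurableSingletonClass T] [Finite B] [MeasurableSpace B]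
    [MeasurableSingletonClass B] {μ : Measure Ω} [IsProbabilityMeasure μ] {F : Ω → B}
    {W : Ω → T} {X : Ω → S} (hF : Measurable F) (hW : Measurable W) (hX : Measurable X)
    (hFW : IndepFun F W μ) (g : B → T → A) (hg : ∀ w, Function.Injective fun f => g f w)
    (φ : S → T) (hφ : ∀ᵐ ω ∂μ, W ω = φ (X ω))
    (h : cmi μ (fun ω => g (F ω) (W ω)) X W = 0) : IndepFun F X μ := by
  have hG : Measurable fun ω => g (F ω) (W ω) :=
    (Measurable.of_discrete (f := fun z : B × T => g z.1 z.2)).comp (hF.prodMk hW)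
  refine indepFun_of_pr_pair hF hX fun f x => ?_
  have key := mul_eq_mul_of_cmi_eq_zero μ hG hX h (g f (φ x)) x (φ x)
  have e1 : pr μ (fun ω => (g (F ω) (W ω), X ω, W ω)) (g f (φ x), x, φ x)
      = pr μ (fun ω => (F ω, X ω)) (f, x) := by
    refine pr_congr_ae ?_
    filter_upwards [hφ] with ω hω
    simp only [Prod.mk.injEq]
    constructor
    · rintro ⟨h1, h2, h3⟩
      rw [h3] at h1
      exact ⟨hg _ h1, h2⟩
    · rintro ⟨rfl, rfl⟩
      simp [hω]
  have e2 : pr μ (fun ω => (g (F ω) (W ω), W ω)) (g f (φ x), φ x)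
      = pr μ F f * pr μ W (φ x) := by
    rw [← pr_pair_of_indepFun hFW]
    refine pr_congr fun ω => ?_
    simp only [Prod.mk.injEq]
    constructor
    · rintro ⟨h1, h3⟩
      rw [h3] at h1
      exact ⟨hg _ h1, h3⟩
    · rintro ⟨rfl, h3⟩
      simp [h3]
  have e3 : pr μ (fun ω => (X ω, W ω)) (x, φ x) = pr μ X x := by
    refine pr_congr_ae ?_
    filter_upwards [hφ] with ω hω
    simp only [Prod.mk.injEq, and_iff_left_iff_imp]
    rintro rfl
    exact hω
  rw [e1, e2, e3] at key
  by_cases hw : pr μ W (φ x) = 0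
  · have hx : pr μ X x = 0 :=
      le_antisymm (by rw [← e3, ← hw]; exact pr_pair_le_right μ X W _ _) (pr_nonneg _ _ _)
    rw [hx, mul_zero]
    exact le_antisymm (hx ▸ pr_pair_le_right μ F X f x) (pr_nonneg _ _ _)
  · refine mul_right_cancel₀ hw (key.trans ?_)
    ring

theorem pr_eq_zero_or_half_of_uniformOn_two [Fintype S] [MeasurableSpace S]
    [MeasurableSingletonClass S] {μ : Measure Ω} [IsProbabilityMeasure μ] {X : Ω → S}
    (hX : Measurable X) (h : UniformOn μ X 2) (x : S) : pr μ X x = 0 ∨ pr μ X x = 2⁻¹ := by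
  classical
  obtain ⟨h1, h2⟩ := h
  rcases (pr_nonneg μ X x).eq_or_lt with hx | hx
  · exact Or.inl hx.symm
  right
  have hsum := sum_pr μ hX
  have hite : ∀ y, pr μ X y = if y ∈ support μ X then pr μ X x else 0 := by
    intro y
    split_ifs with hy
    · exact h1 y hy x hx
    · exact le_antisymm (not_lt.1 hy) (pr_nonneg _ _ _)
  have hcard : (Finset.univ.filter (· ∈ support μ X)).card = 2 := by
    rw [← h2, ← Set.ncard_coe_finset]
    congr 1
    ext y
    simp
  rw [Finset.sum_congr rfl fun y _ => hite y, ← Finset.sum_filter, Finset.sum_const, hcard] at hsum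
  norm_num at hsum
  linarith

/-- A finite-valued random variable can be copied onto a small probability space carrying an
independent fair coin. -/
theorem exists_identDistrib_indepFun_coin [Fintype A] [MeasurableSpace A]
    [MeasurableSingletonClass A] (μ : Measure Ω) [IsProbabilityMeasure μ] {T : Ω → A}
    (hT : Measurable T) :
    ∃ (P : ProbSpace) (T' : P.carrier → A) (C : P.carrier → Fin 2), Measurable T' ∧
      Measurable C ∧ IdentDistrib T T' μ P.μ ∧ IndepFun T' C P.μ ∧ ∀ c, pr P.μ C c = 2⁻¹ := by
  classical
  let eqv := Fintype.equivFin A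
  have hm : Measurable (eqv ∘ T) := (Measurable.of_discrete (f := eqv)).comp hT
  have : IsProbabilityMeasure (μ.map (eqv ∘ T)) :=
    Measure.isProbabilityMeasure_map hm.aemeasurable
  let κ : Measure (Fin 2) := (PMF.uniformOfFintype (Fin 2)).toMeasure
  have hsymm : Measurable eqv.symm := Measurable.of_discrete
  refine ⟨⟨Fin (Fintype.card A) × Fin 2, (μ.map (eqv ∘ T)).prod κ⟩,
    fun p => eqv.symm p.1, fun p => p.2, hsymm.comp measurable_fst, measurable_snd, ?_, ?_, ?_⟩
  · refine ⟨hT.aemeasurable, (hsymm.comp measurable_fst).aemeasurable, ?_⟩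
    change _ = Measure.map (eqv.symm ∘ Prod.fst) ((μ.map (eqv ∘ T)).prod κ)
    rw [← Measure.map_map hsymm measurable_fst, Measure.map_fst_prod, measure_univ, one_smul,
      Measure.map_map hsymm hm]
    congr 1
    ext ω
    simp
  · exact indepFun_prod hsymm measurable_id
  · intro c
    have : (fun p : Fin (Fintype.card A) × Fin 2 => p.2) ⁻¹' {c} = Set.univ ×ˢ {c} := by
      ext
      simp
    simp only [pr]
    rw [this, Measure.prod_prod, measure_univ, one_mul,
      PMF.toMeasure_apply_singleton _ _ (measurableSet_singleton c)]
    simp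

/-- Suppose `F` is an unbiased bit given `Q` on the event `D Q`, and a function of `Q` off it.
Taking `F` itself on that event and an independent coin elsewhere gives a fair bit which is
independent of `Q` and together with `Q` determines `F`. -/
theorem exists_bit_indep_determining [Fintype T] [MeasurableSpace T] [MeasurableSingletonClass T]
    {μ : Measure Ω} [IsProbabilityMeasure μ] {F C : Ω → Fin 2} {Q : Ω → T}
    (hF : Measurable F) (hQ : Measurable Q) (hCm : Measurable C)
    (hC : IndepFun (fun ω => (F ω, Q ω)) C μ) (hC2 : ∀ c, pr μ C c = 2⁻¹) (D : T → Prop)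
    (hD : ∀ q, D q → ∀ f, pr μ (fun ω => (F ω, Q ω)) (f, q) = 2⁻¹ * pr μ Q q)
    (hD' : ∀ q, ¬ D q → ∀ f, pr μ (fun ω => (F ω, Q ω)) (f, q) = 0 ∨
      pr μ (fun ω => (F ω, Q ω)) (f, q) = pr μ Q q) :
    ∃ U : Ω → Fin 2, Measurable U ∧ (∀ u, pr μ U u = 2⁻¹) ∧
    (∀ u q, pr μ (fun ω => (U ω, Q ω)) (u, q) = pr μ U u * pr μ Q q) ∧
    ∀ f q u, pr μ (fun ω => (F ω, (Q ω, U ω))) (f, (q, u)) = 0 ∨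
      pr μ (fun ω => (F ω, (Q ω, U ω))) (f, (q, u)) = pr μ (fun ω => (Q ω, U ω)) (q, u) := by
  classical
  let U : Ω → Fin 2 := fun ω => if D (Q ω) then F ω else C ω
  have hUm : Measurable U :=
    Measurable.ite (hQ (Set.toFinite {q | D q}).measurableSet) hF hCm
  have hCQ : IndepFun Q C μ := hC.comp measurable_snd measurable_id
  have hUQ : ∀ u q, pr μ (fun ω => (U ω, Q ω)) (u, q) = 2⁻¹ * pr μ Q q := by
    intro u q
    by_cases hq : D q
    · rw [← hD q hq u]
      refine pr_congr fun ω => ?_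
      simp only [Prod.mk.injEq, U]
      constructor <;> rintro ⟨h, rfl⟩ <;> simp_all
    · rw [← hC2 u, mul_comm, ← pr_pair_of_indepFun hCQ]
      refine pr_congr fun ω => ?_
      simp only [Prod.mk.injEq, U]
      constructor
      · rintro ⟨h, rfl⟩
        simp_all
      · rintro ⟨rfl, h⟩
        simp_all
  have hU : ∀ u, pr μ U u = 2⁻¹ := by
    intro u
    rw [← sum_pr_pair_right μ U hQ u]
    simp only [hUQ]
    rw [← Finset.mul_sum, sum_pr μ hQ, mul_one]
  refine ⟨U, hUm, hU, fun u q => by rw [hUQ, hU], fun f q u => ?_⟩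
  by_cases hq : D q
  · by_cases hfu : f = u
    · right
      refine pr_congr fun ω => ?_
      simp only [Prod.mk.injEq, U, and_iff_right_iff_imp]
      rintro ⟨rfl, h⟩
      simp_all
    · left
      refine pr_eq_zero_of_forall_ne fun ω h => hfu ?_
      simp only [Prod.mk.injEq, U] at h
      obtain ⟨h1, rfl, h3⟩ := h
      simp_all
  · have e1 : pr μ (fun ω => (F ω, (Q ω, U ω))) (f, (q, u))
        = pr μ (fun ω => (F ω, Q ω)) (f, q) * 2⁻¹ := by
      rw [← hC2 u, ← pr_pair_of_indepFun hC]
      refine pr_congr fun ω => ?_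
      simp only [Prod.mk.injEq, U]
      constructor
      · rintro ⟨h1, rfl, h3⟩
        simp_all
      · rintro ⟨⟨h1, rfl⟩, h3⟩
        simp_all
    have e2 : pr μ (fun ω => (Q ω, U ω)) (q, u) = pr μ Q q * 2⁻¹ := by
      rw [pr_swap, hUQ, mul_comm]
    rw [e1, e2]
    rcases hD' q hq f with h | h <;> simp [h]

end Law

section View

variable {k : ℕ}

/-- The part of the COLD outputs visible on the index sets `S` and `Sb`. -/
def view (S Sb : Finset (Fin k)) (w : Fin k → Fin 2) (f : Fin 2) :
    (S → Fin 2) × (Sb → Fin 2) :=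
  (fun i => (1 - w i.1) * f, fun i => w i.1 * f)

/-- The bits of `w` are `1` on `S` and `0` on `Sb`. -/
def Sat (S Sb : Finset (Fin k)) (w : Fin k → Fin 2) : Prop :=
  (∀ i ∈ S, w i = 1) ∧ ∀ i ∈ Sb, w i = 0

theorem view_zero_right (S Sb : Finset (Fin k)) (w : Fin k → Fin 2) : view S Sb w 0 = 0 := by
  ext <;> simp [view]

theorem view_one_eq_zero_iff (S Sb : Finset (Fin k)) (w : Fin k → Fin 2) :
    view S Sb w 1 = 0 ↔ Sat S Sb w := by
  simp only [view, Sat, Prod.ext_iff, funext_iff, Prod.fst_zero, Prod.snd_zero, Pi.zero_apply,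
    mul_one, Subtype.forall, sub_eq_zero, eq_comm (a := (1 : Fin 2))]

variable {Ω SX SE : Type*} [MeasurableSpace Ω] {μ : Measure Ω} {F : Ω → Fin 2}
  {W : Ω → Fin k → Fin 2} {X : Ω → SX} {E : Ω → SE} {S Sb : Finset (Fin k)}

theorem pr_one_view_zero (e : SE) :
    pr μ (fun ω => (F ω, (E ω, view S Sb (W ω) (F ω)))) (1, (e, 0))
      = pr μ (fun ω => (F ω, (E ω, Sat S Sb (W ω)))) (1, (e, True)) := by
  refine pr_congr fun ω => ?_
  simp only [Prod.mk.injEq, eq_iff_iff, iff_true]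
  constructor <;> rintro ⟨h1, h2, h3⟩ <;> rw [h1] at * <;>
    simp_all [view_one_eq_zero_iff]

theorem pr_zero_view_zero (e : SE) :
    pr μ (fun ω => (F ω, (E ω, view S Sb (W ω) (F ω)))) (0, (e, 0))
      = pr μ (fun ω => (F ω, E ω)) (0, e) := by
  refine pr_congr fun ω => ?_
  simp only [Prod.mk.injEq]
  constructor
  · rintro ⟨h1, h2, h3⟩
    exact ⟨h1, h2⟩
  · rintro ⟨h1, h2⟩
    rw [h1, view_zero_right]
    exact ⟨rfl, h2, rfl⟩

theorem pr_zero_view_of_ne_zero (e : SE) {o : (S → Fin 2) × (Sb → Fin 2)} (ho : o ≠ 0) :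
    pr μ (fun ω => (F ω, (E ω, view S Sb (W ω) (F ω)))) (0, (e, o)) = 0 := by
  refine pr_eq_zero_of_forall_ne fun ω h => ?_
  simp only [Prod.mk.injEq] at h
  obtain ⟨h1, -, h2⟩ := h
  rw [h1, view_zero_right] at h2
  exact ho h2.symm

theorem pr_sat_eq_aCount [Fintype SX] [Fintype SE] [MeasurableSpace SX]
    [MeasurableSingletonClass SX] [IsFiniteMeasure μ] (hX : Measurable X)
    {w : SX → Fin k → Fin 2} (hw : ∀ᵐ ω ∂μ, W ω = w (X ω)) (hsplit : Splits μ X E 2)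
    {e : SE} (he : 0 < pr μ E e) :
    pr μ (fun ω => (E ω, Sat S Sb (W ω))) (e, True)
      = aCount μ k X E w S Sb e * (pr μ E e / 2) := by
  classical
  rw [← sum_pr_pair μ hX]
  have hterm : ∀ x, pr μ (fun ω => (X ω, (E ω, Sat S Sb (W ω)))) (x, (e, True))
      = if 0 < pr μ (fun ω => (X ω, E ω)) (x, e) ∧ Sat S Sb (w x)
        then pr μ E e / 2 else 0 := by
    intro x
    by_cases hs : Sat S Sb (w x)
    · have e1 : pr μ (fun ω => (X ω, (E ω, Sat S Sb (W ω)))) (x, (e, True))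
          = pr μ (fun ω => (X ω, E ω)) (x, e) := by
        refine pr_congr_ae ?_
        filter_upwards [hw] with ω hω
        simp only [Prod.mk.injEq, eq_iff_iff, iff_true, hω]
        constructor
        · rintro ⟨h1, h2, -⟩
          exact ⟨h1, h2⟩
        · rintro ⟨rfl, h2⟩
          exact ⟨rfl, h2, hs⟩
      rw [e1]
      split_ifs with hpos
      · simpa [hpos.1.ne'] using (hsplit.2 e he).1 x
      · exact le_antisymm (not_lt.1 fun h => hpos ⟨h, hs⟩) (pr_nonneg _ _ _)
    · rw [if_neg fun h => hs h.2]
      have e1 : pr μ (fun ω => (X ω, (E ω, Sat S Sb (W ω)))) (x, (e, True))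
          = pr μ (fun _ : Ω => False) True := by
        refine pr_congr_ae ?_
        filter_upwards [hw] with ω hω
        simp only [Prod.mk.injEq, eq_iff_iff, iff_true, hω, iff_false]
        rintro ⟨rfl, -, h⟩
        exact hs h
      rw [e1]
      exact pr_eq_zero_of_forall_ne (by simp)
  rw [Finset.sum_congr rfl fun x _ => hterm x, ← Finset.sum_filter, Finset.sum_const,
    nsmul_eq_mul, aCount, ← Set.ncard_coe_finset]
  congr 3
  ext x
  exact Finset.mem_filter_univ x

theorem aCount_le_two [Fintype SX] [Fintype SE] (w : SX → Fin k → Fin 2)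
    (hsplit : Splits μ X E 2) {e : SE} (he : 0 < pr μ E e) : aCount μ k X E w S Sb e ≤ 2 := by
  rw [← (hsplit.2 e he).2]
  exact Set.ncard_le_ncard (fun x hx => hx.1) (Set.toFinite _)

variable [MeasurableSpace SE] [MeasurableSingletonClass SE]

theorem pr_one_view_zero_of_indepFun [Finite SE] (hF2 : ∀ f, pr μ F f = 2⁻¹)
    (hind : IndepFun F (fun ω => (E ω, W ω)) μ) (e : SE) :
    pr μ (fun ω => (F ω, (E ω, view S Sb (W ω) (F ω)))) (1, (e, 0))
      = 2⁻¹ * pr μ (fun ω => (E ω, Sat S Sb (W ω))) (e, True) := by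
  have h : IndepFun F (fun ω => (E ω, Sat S Sb (W ω))) μ := hind.comp measurable_id
    (Measurable.of_discrete (f := fun z : SE × (Fin k → Fin 2) => (z.1, Sat S Sb z.2)))
  rw [pr_one_view_zero, pr_pair_of_indepFun h, hF2]

theorem pr_zero_view_zero_of_indepFun (hF2 : ∀ f, pr μ F f = 2⁻¹)
    (hind : IndepFun F (fun ω => (E ω, W ω)) μ) (e : SE) :
    pr μ (fun ω => (F ω, (E ω, view S Sb (W ω) (F ω)))) (0, (e, 0)) = 2⁻¹ * pr μ E e := by
  have h : IndepFun F E μ := hind.comp measurable_id measurable_fst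
  rw [pr_zero_view_zero, pr_pair_of_indepFun h, hF2]

theorem pr_view_zero_of_indepFun [IsFiniteMeasure μ] [Finite SE] (hF : Measurable F)
    (hF2 : ∀ f, pr μ F f = 2⁻¹)
    (hind : IndepFun F (fun ω => (E ω, W ω)) μ) (e : SE) :
    pr μ (fun ω => (E ω, view S Sb (W ω) (F ω))) (e, 0)
      = 2⁻¹ * pr μ E e + 2⁻¹ * pr μ (fun ω => (E ω, Sat S Sb (W ω))) (e, True) := by
  rw [← sum_pr_pair μ hF, Fin.sum_univ_two, pr_one_view_zero_of_indepFun hF2 hind,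
    pr_zero_view_zero_of_indepFun hF2 hind]


end View

section Dichotomy

variable {k : ℕ} {Ω SE : Type*} [MeasurableSpace Ω] {μ : Measure Ω} [IsProbabilityMeasure μ]
  {F : Ω → Fin 2} {W : Ω → Fin k → Fin 2} {E : Ω → SE} {S Sb : Finset (Fin k)}
  [Fintype SE] [MeasurableSpace SE] [MeasurableSingletonClass SE]

theorem pr_view_half_of_sat (hF : Measurable F) (hW : Measurable W)
    (hF2 : ∀ f, pr μ F f = 2⁻¹) (hind : IndepFun F (fun ω => (E ω, W ω)) μ) {e : SE}
    (hs : pr μ (fun ω => (E ω, Sat S Sb (W ω))) (e, True) = pr μ E e)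
    (o : (S → Fin 2) × (Sb → Fin 2)) (f : Fin 2) :
    pr μ (fun ω => (F ω, (E ω, view S Sb (W ω) (F ω)))) (f, (e, o))
      = 2⁻¹ * pr μ (fun ω => (E ω, view S Sb (W ω) (F ω))) (e, o) := by
  have h0 := pr_view_zero_of_indepFun (S := S) (Sb := Sb) hF hF2 hind e
  rw [hs] at h0
  by_cases ho : o = 0
  · subst ho
    rw [h0]
    fin_cases f
    · exact (pr_zero_view_zero_of_indepFun hF2 hind e).trans (by ring)
    · exact (pr_one_view_zero_of_indepFun hF2 hind e).trans (by rw [hs]; ring)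
  · have hO : Measurable fun ω => view S Sb (W ω) (F ω) :=
      (Measurable.of_discrete (f := fun z : (Fin k → Fin 2) × Fin 2 =>
        view S Sb z.1 z.2)).comp (hW.prodMk hF)
    have hsum := sum_pr_pair_right μ E hO e
    have hz : pr μ (fun ω => (E ω, view S Sb (W ω) (F ω))) (e, o) = 0 := by
      have hle := Finset.add_le_sum (fun i _ => pr_nonneg μ
        (fun ω => (E ω, view S Sb (W ω) (F ω))) (e, i)) (Finset.mem_univ o)
        (Finset.mem_univ 0) ho
      rw [hsum, h0] at hle
      exact le_antisymm (by linarith) (pr_nonneg _ _ _)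
    rw [hz, mul_zero]
    exact le_antisymm (hz ▸ pr_pair_le_right μ F _ f (e, o)) (pr_nonneg _ _ _)

theorem pr_view_deterministic_of_not_sat (hF : Measurable F)
    (hF2 : ∀ f, pr μ F f = 2⁻¹) (hind : IndepFun F (fun ω => (E ω, W ω)) μ) {e : SE}
    (hs : pr μ (fun ω => (E ω, Sat S Sb (W ω))) (e, True) = 0)
    (o : (S → Fin 2) × (Sb → Fin 2)) (f : Fin 2) :
    pr μ (fun ω => (F ω, (E ω, view S Sb (W ω) (F ω)))) (f, (e, o)) = 0 ∨
      pr μ (fun ω => (F ω, (E ω, view S Sb (W ω) (F ω)))) (f, (e, o))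
        = pr μ (fun ω => (E ω, view S Sb (W ω) (F ω))) (e, o) := by
  have hsum := sum_pr_pair μ hF (fun ω => (E ω, view S Sb (W ω) (F ω))) (e, o)
  rw [Fin.sum_univ_two] at hsum
  have key : pr μ (fun ω => (F ω, (E ω, view S Sb (W ω) (F ω)))) (0, (e, o)) = 0 ∨
      pr μ (fun ω => (F ω, (E ω, view S Sb (W ω) (F ω)))) (1, (e, o)) = 0 := by
    by_cases ho : o = 0
    · right
      rw [ho, pr_one_view_zero_of_indepFun hF2 hind, hs, mul_zero]
    · exact Or.inl (pr_zero_view_of_ne_zero e ho)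
  rcases key with h | h <;> fin_cases f <;> simp only [Fin.zero_eta, Fin.mk_one] <;>
    first
    | exact Or.inl h
    | exact Or.inr (by rw [← hsum, h]; ring)

end Dichotomy

/-- in the COLD setup with E splitting X into sets of size 2, a uniform
2-valued U with I(U;(E,V_S,V̄_S̄)) = 0 and H(F|V_S,V̄_S̄,E,U) = 0 can be adjoined iff
aCount μ k X E wfun S Sb e ≠ 1 holds for every e of positive probability. -/
theorem stmt_9 {Ω : Type*} [MeasurableSpace Ω] (μ : Measure Ω) [IsProbabilityMeasure μ]
    (k : ℕ) (hk : 1 ≤ k)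
    (F : Ω → Fin 2) (W : Ω → (Fin k → Fin 2))
    (hFm : Measurable F) (hWm : Measurable W)
    (hFunif : ∀ x : Fin 2, pr μ F x = 2⁻¹)
    (hindep : IndepFun F W μ)
    (V Vb : Fin k → Ω → Fin 2)
    (hV : ∀ i ω, V i ω = (1 - W ω i) * F ω)
    (hVb : ∀ i ω, Vb i ω = W ω i * F ω)
    {SX SE : Type*} [Fintype SX] [Fintype SE]
    [MeasurableSpace SX] [MeasurableSingletonClass SX]
    [MeasurableSpace SE] [MeasurableSingletonClass SE]
    (X : Ω → SX) (hXm : Measurable X)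
    (wfun : SX → (Fin k → Fin 2)) (hwfun : μ {ω | W ω = wfun (X ω)} = 1)
    (hcmi : cmi μ (fun ω => ((fun i => V i ω), (fun i => Vb i ω), F ω)) X W = 0)
    (E : Ω → SE) (hEm : Measurable E) (hsplit : Splits μ X E 2)
    (S Sb : Finset (Fin k)) :
    (∃ (P : ProbSpace) (F' : P.carrier → Fin 2) (W' : P.carrier → (Fin k → Fin 2))
      (X' : P.carrier → SX) (E' : P.carrier → SE)
      (TU : FinAlphabet) (U : P.carrier → TU.carrier),
      Measurable F' ∧ Measurable W' ∧ Measurable X' ∧ Measurable E' ∧ Measurable U ∧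
      IdentDistrib (fun ω => (F ω, W ω, X ω, E ω))
        (fun ω => (F' ω, W' ω, X' ω, E' ω)) μ P.μ ∧
      UniformOn P.μ U 2 ∧
      mi P.μ U (fun ω => (E' ω, (fun i : S => (1 - W' ω i.1) * F' ω),
        (fun i : Sb => W' ω i.1 * F' ω))) = 0 ∧
      condEnt P.μ F' (fun ω => ((fun i : S => (1 - W' ω i.1) * F' ω),
        (fun i : Sb => W' ω i.1 * F' ω), E' ω, U ω)) = 0) ↔
    (∀ e : SE, 0 < pr μ E e → aCount μ k X E wfun S Sb e ≠ 1) := by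
  classical
  have hw : ∀ᵐ ω ∂μ, W ω = wfun (X ω) := by
    have hwX : Measurable fun ω => wfun (X ω) := (Measurable.of_discrete (f := wfun)).comp hXm
    exact (mem_ae_iff_prob_eq_one (measurableSet_eq_fun hWm hwX)).2 hwfun
  have hFX : IndepFun F X μ := by
    refine indepFun_of_cmi_eq_zero hFm hWm hXm hindep
      (fun f w => ((fun i => (1 - w i) * f), (fun i => w i * f), f))
      (fun w f f' h => congrArg (fun z => z.2.2) h) wfun hw ?_
    simpa only [hV, hVb] using hcmi
  obtain ⟨ε, hε⟩ := exists_ae_eq_comp_of_condEnt_eq_zero hEm hXm hsplit.1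
  have hind : IndepFun F (fun ω => (E ω, W ω)) μ := by
    have := hFX.comp measurable_id (Measurable.of_discrete (f := fun x => (ε x, wfun x)))
    refine this.congr (ae_of_all _ fun _ => rfl) ?_
    filter_upwards [hw, hε] with ω h1 h2
    simp [h1, h2]
  let T : Ω → Fin 2 × (Fin k → Fin 2) × SX × SE := fun ω => (F ω, W ω, X ω, E ω)
  have hT : Measurable T := hFm.prodMk (hWm.prodMk (hXm.prodMk hEm))
  let gQ : Fin 2 × (Fin k → Fin 2) × SX × SE → SE × (S → Fin 2) × (Sb → Fin 2) :=
    fun t => (t.2.2.2, view S Sb t.2.1 t.1)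
  constructor
  · rintro ⟨P, F', W', X', E', TU, U, hF', hW', hX', hE', hU, hid, hunif, hmi, hce⟩ e he ha
    let T' : P.carrier → Fin 2 × (Fin k → Fin 2) × SX × SE := fun ω => (F' ω, W' ω, X' ω, E' ω)
    have hT' : Measurable T' := hF'.prodMk (hW'.prodMk (hX'.prodMk hE'))
    have hQ' : Measurable (fun p => gQ (T' p)) := (Measurable.of_discrete (f := gQ)).comp hT'
    have hs := pr_sat_eq_aCount (S := S) (Sb := Sb) hXm hw hsplit he
    rw [ha, Nat.cast_one, one_mul] at hs
    have hq : pr P.μ (fun p => gQ (T' p)) (e, 0) = 3 / 4 * pr μ E e := by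
      refine (pr_comp_eq_of_identDistrib hid gQ (e, 0)).trans
        ((pr_view_zero_of_indepFun hFm hFunif hind e).trans ?_)
      rw [hs]
      ring
    have h1q : pr P.μ (fun p => (F' p, gQ (T' p))) (1, (e, 0)) = 1 / 4 * pr μ E e := by
      refine (pr_comp_eq_of_identDistrib hid (fun t => (t.1, gQ t)) (1, (e, 0))).trans
        ((pr_one_view_zero_of_indepFun hFunif hind e).trans ?_)
      rw [hs]
      ring
    have hUq : ∀ u, pr P.μ (fun p => (U p, gQ (T' p))) (u, (e, 0))
        = pr P.μ U u * pr P.μ (fun p => gQ (T' p)) (e, 0) := fun u =>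
      (mi_eq_zero_iff P.μ hU hQ').1 hmi u (e, 0)
    have hval : ∀ u, pr P.μ (fun p => (U p, (F' p, gQ (T' p)))) (u, (1, (e, 0))) = 0 ∨
        pr P.μ (fun p => (U p, (F' p, gQ (T' p)))) (u, (1, (e, 0))) = 3 / 8 * pr μ E e := by
      intro u
      have e1 : pr P.μ (fun p => (U p, (F' p, gQ (T' p)))) (u, (1, (e, 0)))
          = pr P.μ (fun p => (F' p, ((fun i : S => (1 - W' p i.1) * F' p),
            (fun i : Sb => W' p i.1 * F' p), E' p, U p))) (1, (0, 0, e, u)) := by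
        refine pr_congr fun p => ?_
        simp only [gQ, T', view, Prod.mk.injEq, Prod.mk_eq_zero]
        tauto
      have e2 : pr P.μ (fun p => ((fun i : S => (1 - W' p i.1) * F' p),
            (fun i : Sb => W' p i.1 * F' p), E' p, U p)) (0, 0, e, u)
          = pr P.μ (fun p => (U p, gQ (T' p))) (u, (e, 0)) := by
        refine pr_congr fun p => ?_
        simp only [gQ, T', view, Prod.mk.injEq, Prod.mk_eq_zero]
        tauto
      have h3 := (condEnt_eq_zero_iff P.μ hF' _).1 hce 1 (0, 0, e, u)
      rw [← e1, e2, hUq, hq] at h3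
      rcases h3 with h3 | h3
      · exact Or.inl h3
      · rcases pr_eq_zero_or_half_of_uniformOn_two hU hunif u with h4 | h4
        · left
          rw [h3, h4, zero_mul]
        · right
          rw [h3, h4]
          ring
    have hsum := sum_pr_pair P.μ hU (fun p => (F' p, gQ (T' p))) (1, (e, 0))
    rw [h1q] at hsum
    obtain ⟨u, -, hu⟩ := Finset.exists_ne_zero_of_sum_ne_zero
      (hsum.trans_ne (by positivity))
    have hle := Finset.single_le_sum (fun u _ => pr_nonneg P.μ
      (fun p => (U p, (F' p, gQ (T' p)))) (u, (1, (e, 0)))) (Finset.mem_univ u)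
    rw [hsum, (hval u).resolve_left hu] at hle
    linarith
  · intro ha
    obtain ⟨P, T', C, hT', hC, hid, hTC, hC2⟩ := exists_identDistrib_indepFun_coin μ hT
    have hQ' : Measurable (fun p => gQ (T' p)) := (Measurable.of_discrete (f := gQ)).comp hT'
    let D : SE × (S → Fin 2) × (Sb → Fin 2) → Prop := fun q =>
      0 < pr μ E q.1 ∧ aCount μ k X E wfun S Sb q.1 = 2
    have hQeq := fun q => pr_comp_eq_of_identDistrib hid gQ q
    have hFQeq := fun z => pr_comp_eq_of_identDistrib hid (fun t => (t.1, gQ t)) z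
    have hD : ∀ q, D q → ∀ f, pr P.μ (fun p => ((T' p).1, gQ (T' p))) (f, q)
        = 2⁻¹ * pr P.μ (fun p => gQ (T' p)) q := by
      rintro ⟨e, o⟩ ⟨he, h2⟩ f
      rw [hQeq, hFQeq]
      refine pr_view_half_of_sat hFm hWm hFunif hind ?_ o f
      rw [pr_sat_eq_aCount hXm hw hsplit he, h2]
      push_cast
      ring
    have hD' : ∀ q, ¬ D q → ∀ f, pr P.μ (fun p => ((T' p).1, gQ (T' p))) (f, q) = 0 ∨
        pr P.μ (fun p => ((T' p).1, gQ (T' p))) (f, q) = pr P.μ (fun p => gQ (T' p)) q := by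
      rintro ⟨e, o⟩ hq f
      rw [hQeq, hFQeq]
      refine pr_view_deterministic_of_not_sat hFm hFunif hind ?_ o f
      rcases (pr_nonneg μ E e).eq_or_lt with he | he
      · exact le_antisymm (he ▸ pr_pair_le_left μ E _ e True) (pr_nonneg _ _ _)
      · have h0 : aCount μ k X E wfun S Sb e = 0 := by
          have h1 := aCount_le_two (S := S) (Sb := Sb) wfun hsplit he
          have h2 : aCount μ k X E wfun S Sb e ≠ 2 := fun h => hq ⟨he, h⟩
          have h3 := ha e he
          omega
        rw [pr_sat_eq_aCount hXm hw hsplit he, h0, Nat.cast_zero, zero_mul]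
    have hFQC : IndepFun (fun p => ((T' p).1, gQ (T' p))) C P.μ :=
      hTC.comp (Measurable.of_discrete (f := fun t => (t.1, gQ t))) measurable_id
    obtain ⟨U, hU, hU2, hUQ, hdet⟩ :=
      exists_bit_indep_determining (measurable_fst.comp hT') hQ' hC hFQC hC2 D hD hD'
    refine ⟨P, fun p => (T' p).1, fun p => (T' p).2.1, fun p => (T' p).2.2.1,
      fun p => (T' p).2.2.2, ⟨Fin 2⟩, U,
      measurable_fst.comp hT', measurable_fst.comp (measurable_snd.comp hT'),
      measurable_fst.comp (measurable_snd.comp (measurable_snd.comp hT')),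
      measurable_snd.comp (measurable_snd.comp (measurable_snd.comp hT')), hU, hid,
      ⟨fun x _ y _ => (hU2 x).trans (hU2 y).symm, ?_⟩,
      (mi_eq_zero_iff P.μ hU hQ').2 hUQ, ?_⟩
    · have : support P.μ U = Set.univ := by
        ext u
        simp [support, hU2]
      rw [this, Set.ncard_univ, Nat.card_eq_fintype_card]
      exact Fintype.card_fin 2
    · refine (condEnt_eq_zero_iff P.μ (measurable_fst.comp hT') _).2 ?_
      rintro f ⟨o, o', e, u⟩
      have e1 := pr_comp_of_injective
        (g := fun z : Fin 2 × (SE × (S → Fin 2) × (Sb → Fin 2)) × Fin 2 =>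
          (z.1, z.2.1.2.1, z.2.1.2.2, z.2.1.1, z.2.2)) (by rintro ⟨⟩ ⟨⟩ h; grind) P.μ
        (fun p => ((T' p).1, (gQ (T' p), U p)))
        (f, ((e, o, o'), u))
      have e2 := pr_comp_of_injective
        (g := fun z : (SE × (S → Fin 2) × (Sb → Fin 2)) × Fin 2 =>
          (z.1.2.1, z.1.2.2, z.1.1, z.2)) (by rintro ⟨⟩ ⟨⟩ h; grind) P.μ
        (fun p => (gQ (T' p), U p)) ((e, o, o'), u)
      rcases hdet f (e, o, o') u with h | h
      · exact Or.inl (e1.trans h)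
      · exact Or.inr (e1.trans (h.trans e2.symm))

end CIPaper
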